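/- Let μ be a probability measure on ℝ with infinite support and all moments finite, x* ∈ ℝ, α ≥ 0, and let f : ℝ → ℝ be Lipschitz with |f(x) − f(y)| ≤ |f|_L |x − y| for all x, y. Then for every n ∈ ℕ the OPE of size n associated with μ satisfies Var X_{f,α,x*}^{(n)} ≤ |f|_L² (γ_{n−1}/γ_n)² n^{2α}. In particular, if μ has compact support, then for α = 0 the variance Var X_f^{(n)} is bounded uniformly in n. -/

import Mathlib

open MeasureTheory ProbabilityTheory Filter Topology

noncomputable section

/-- The squared Vandermonde determinant `∏_{i>j} (λ_i - λ_j)^2`. -/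
def vandSq {n : ℕ} (l : Fin n → ℝ) : ℝ :=
  ∏ q ∈ Finset.univ.filter (fun q : Fin n × Fin n => q.2 < q.1), (l q.1 - l q.2) ^ 2

/-- The orthogonal polynomial ensemble of size `n` associated with `μ`: the probability
measure on `ℝ^n` proportional to `∏_{i>j}(λ_i-λ_j)^2 dμ(λ_1)⋯dμ(λ_n)`. -/
def OPE (μ : Measure ℝ) (n : ℕ) : Measure (Fin n → ℝ) :=
  ((((Measure.pi fun _ : Fin n => μ).withDensity fun l => ENNReal.ofReal (vandSq l))
    Set.univ)⁻¹) •
    ((Measure.pi fun _ : Fin n => μ).withDensity fun l => ENNReal.ofReal (vandSq l))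

/-- The linear statistic `X_f = ∑ f(λ_j)`. -/
def linStat {n : ℕ} (f : ℝ → ℝ) (l : Fin n → ℝ) : ℝ := ∑ j, f (l j)

/-- The scaled linear statistic `X_{f,α,x*} = ∑ f(n^α (λ_j - x*))`. -/
def scaledLinStat {n : ℕ} (f : ℝ → ℝ) (α xs : ℝ) (l : Fin n → ℝ) : ℝ :=
  ∑ j, f ((n : ℝ) ^ α * (l j - xs))

/-- `p` is the family of orthonormal polynomials of `μ`: `p j` has degree `j`, positive
leading coefficient, and `∫ p_i p_j dμ = δ_{ij}`. -/
def IsOrthonormalPolys (μ : Measure ℝ) (p : ℕ → Polynomial ℝ) : Prop :=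
  (∀ j, (p j).degree = (j : WithBot ℕ)) ∧ (∀ j, 0 < (p j).leadingCoeff) ∧
    ∀ i j, ∫ x, (p i).eval x * (p j).eval x ∂μ = if i = j then 1 else 0

/-- All moments of `μ` are finite. -/
def HasAllMoments (μ : Measure ℝ) : Prop := ∀ k : ℕ, Integrable (fun x : ℝ => x ^ k) μ

/-- `μ` has infinite support: no finite set carries full `μ`-measure. -/
def InfiniteSupport (μ : Measure ℝ) : Prop := ∀ s : Finset ℝ, μ ((↑s : Set ℝ)ᶜ) ≠ 0

/-- The Christoffel–Darboux kernel `K_n(x,y) = ∑_{j<n} p_j(x) p_j(y)`. -/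
def CDKernel (p : ℕ → Polynomial ℝ) (n : ℕ) (x y : ℝ) : ℝ :=
  ∑ j ∈ Finset.range n, (p j).eval x * (p j).eval y

/-- The sup norm `‖f‖_∞` of a (bounded) function. -/
def supNorm (f : ℝ → ℝ) : ℝ := ⨆ x, |f x|

/-- The (topological) support of a measure on `ℝ`. -/
def measSupport (μ : Measure ℝ) : Set ℝ := {x | ∀ U ∈ 𝓝 x, μ U ≠ 0}

/-- The sine kernel `sin(πt)/(πt)` (equal to `1` at `t = 0`). -/
def sineKernel (t : ℝ) : ℝ := if t = 0 then 1 else Real.sin (Real.pi * t) / (Real.pi * t)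

/-- `K̃_n(x,y) = w(x)^{1/2} w(y)^{1/2} K_n(x,y)`, where `w` is the Radon–Nikodym
derivative of `μ` with respect to Lebesgue measure. -/
def tildeK (μ : Measure ℝ) (Kf : ℝ → ℝ → ℝ) (x y : ℝ) : ℝ :=
  Real.sqrt ((μ.rnDeriv volume x).toReal) * Real.sqrt ((μ.rnDeriv volume y).toReal) * Kf x y

/-- The Nevai condition at `x*` for a sequence of measures with kernels `Kf n`. -/
def NevaiCond (μ : ℕ → Measure ℝ) (Kf : ℕ → ℝ → ℝ → ℝ) (xs : ℝ) : Prop :=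
  ∀ f : ℝ → ℝ, Continuous f → HasCompactSupport f →
    Tendsto (fun n => ∫ y, (f y - f xs) * Kf n xs y ^ 2 / Kf n xs xs ∂(μ n)) atTop (𝓝 0)

/-- The `α`-Nevai condition at `x*` for a sequence of measures with kernels `Kf n`. -/
def AlphaNevaiCond (μ : ℕ → Measure ℝ) (Kf : ℕ → ℝ → ℝ → ℝ) (α xs : ℝ) : Prop :=
  ∀ f : ℝ → ℝ, Continuous f → HasCompactSupport f →
    ∀ S : Set ℝ, IsCompact S →
      TendstoUniformlyOn
        (fun n s => ∫ y, (f s - f ((n : ℝ) ^ α * (y - xs))) *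
            Kf n (xs + s / (n : ℝ) ^ α) y ^ 2 /
            Kf n (xs + s / (n : ℝ) ^ α) (xs + s / (n : ℝ) ^ α) ∂(μ n))
        (fun _ => 0) atTop S

open Matrix in
/-- The determinant of a matrix which agrees with the identity outside two rows. -/
lemma det_two_rows {n : ℕ} {a b : Fin n} (hab : a ≠ b) (u v : Fin n → ℝ) :
    (of fun i k => if i = a then u k else if i = b then v k else
      (1 : Matrix (Fin n) (Fin n) ℝ) i k).det = u a * v b - u b * v a := by
  have key : (of fun i k => if i = a then u k else if i = b then v k else
      (1 : Matrix (Fin n) (Fin n) ℝ) i k) =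
      1 + (of fun i (s : Fin 2) =>
        ![(1 : Matrix (Fin n) (Fin n) ℝ) a, (1 : Matrix (Fin n) (Fin n) ℝ) b] s i) *
        (of fun s k =>
          ![u - (1 : Matrix (Fin n) (Fin n) ℝ) a, v - (1 : Matrix (Fin n) (Fin n) ℝ) b] s k) := by
    ext i k
    simp only [Matrix.add_apply, Matrix.mul_apply, of_apply, Fin.sum_univ_two]
    rcases eq_or_ne i a with rfl | hia
    · simp [hab.symm, one_apply]
    rcases eq_or_ne i b with rfl | hib
    · simp [hab, hia, one_apply]
    · simp [hia, hib, one_apply, hia.symm, hib.symm]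
  rw [key, det_one_add_mul_comm, det_fin_two]
  simp [Matrix.mul_apply, one_apply, hab, hab.symm]

open Matrix in
/-- The determinant of a matrix which agrees with the identity outside one row. -/
lemma det_one_row {n : ℕ} (a : Fin n) (u : Fin n → ℝ) :
    (of fun i k => if i = a then u k else (1 : Matrix (Fin n) (Fin n) ℝ) i k).det = u a := by
  have key : (of fun i k => if i = a then u k else (1 : Matrix (Fin n) (Fin n) ℝ) i k) =
      1 + replicateCol Unit (fun i => if i = a then (1 : ℝ) else 0) *
        replicateRow Unit (fun k => u k - (1 : Matrix (Fin n) (Fin n) ℝ) a k) := by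
    ext i k
    simp only [Matrix.add_apply, Matrix.mul_apply, of_apply]
    rcases eq_or_ne i a with rfl | hia
    · simp
    · simp [hia]
  rw [key, det_one_add_replicateCol_mul_replicateRow]
  simp [dotProduct]

open Matrix in
/-- The square of the determinant `det (φ_j (λ_i))`, expanded along one of its factors. -/
lemma prod_mul_det_sq {n : ℕ} (φ h : Fin n → ℝ → ℝ) (l : Fin n → ℝ) :
    (∏ i, h i (l i)) * (of fun j i => φ j (l i)).det ^ 2 =
      ∑ σ : Equiv.Perm (Fin n), ∑ τ : Equiv.Perm (Fin n), ((Equiv.Perm.sign τ : ℤ) : ℝ) *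
        ∏ i, (h i (l i) * (φ (σ i) (l i) * φ (σ (τ i)) (l i))) := by
  conv_lhs => rw [pow_two]; enter [2, 1]; rw [det_apply']
  rw [Finset.sum_mul, Finset.mul_sum]
  refine Finset.sum_congr rfl fun σ _ => ?_
  have h1 := det_permute σ (of fun j i => φ j (l i))
  have h2 := det_apply' ((of fun j i => φ j (l i)).submatrix σ id)
  rw [mul_right_comm, ← h1, h2, mul_comm, mul_assoc, Finset.sum_mul]
  refine Finset.sum_congr rfl fun τ _ => ?_
  simp only [of_apply, submatrix_apply, id, Finset.prod_mul_distrib]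
  ring

section Andreief

variable {μ : Measure ℝ} [IsProbabilityMeasure μ] {n : ℕ} {φ h : Fin n → ℝ → ℝ}

open Matrix in
lemma integrable_prod_mul_det_sq
    (hint : ∀ i j k, Integrable (fun x => h i x * (φ j x * φ k x)) μ) :
    Integrable (fun l : Fin n → ℝ => (∏ i, h i (l i)) * (of fun j i => φ j (l i)).det ^ 2)
      (Measure.pi fun _ : Fin n => μ) := by
  simp only [prod_mul_det_sq]
  refine integrable_finsetSum _ fun σ _ => integrable_finsetSum _ fun τ _ => ?_
  exact (Integrable.fintype_prod (f := fun i x => h i x * (φ (σ i) x * φ (σ (τ i)) x))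
    fun i => hint _ _ _).const_mul _

open Matrix in
/-- Andréief's identity with a separate weight in every coordinate. -/
lemma integral_prod_mul_det_sq
    (hint : ∀ i j k, Integrable (fun x => h i x * (φ j x * φ k x)) μ) :
    ∫ l : Fin n → ℝ, (∏ i, h i (l i)) * (of fun j i => φ j (l i)).det ^ 2
        ∂(Measure.pi fun _ : Fin n => μ) =
      ∑ σ : Equiv.Perm (Fin n),
        (of fun i k => ∫ x, h i x * (φ (σ i) x * φ (σ k) x) ∂μ).det := by
  simp only [prod_mul_det_sq]
  have hi (σ τ : Equiv.Perm (Fin n)) :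
      Integrable (fun l : Fin n → ℝ => ((Equiv.Perm.sign τ : ℤ) : ℝ) *
        ∏ i, (h i (l i) * (φ (σ i) (l i) * φ (σ (τ i)) (l i))))
        (Measure.pi fun _ : Fin n => μ) :=
    (Integrable.fintype_prod (f := fun i x => h i x * (φ (σ i) x * φ (σ (τ i)) x))
      fun i => hint _ _ _).const_mul _
  rw [integral_finsetSum _ fun σ _ => integrable_finsetSum _ fun τ _ => hi σ τ]
  refine Finset.sum_congr rfl fun σ _ => ?_
  rw [integral_finsetSum _ fun τ _ => hi σ τ, ← det_transpose, det_apply']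
  refine Finset.sum_congr rfl fun τ _ => ?_
  rw [integral_const_mul,
    integral_fintype_prod_eq_prod (fun i x => h i x * (φ (σ i) x * φ (σ (τ i)) x))]
  rfl

end Andreief

section Moments

variable {μ : Measure ℝ} [IsProbabilityMeasure μ] {n : ℕ} {φ : Fin n → ℝ → ℝ} {g : ℝ → ℝ}

open Matrix in
lemma integral_det_sq (h0 : ∀ j k, Integrable (fun x => φ j x * φ k x) μ)
    (horth : ∀ j k, ∫ x, φ j x * φ k x ∂μ = (1 : Matrix (Fin n) (Fin n) ℝ) j k) :
    Integrable (fun l : Fin n → ℝ => (of fun j i => φ j (l i)).det ^ 2)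
        (Measure.pi fun _ : Fin n => μ) ∧
      ∫ l : Fin n → ℝ, (of fun j i => φ j (l i)).det ^ 2 ∂(Measure.pi fun _ : Fin n => μ) =
        n.factorial := by
  have hint : ∀ i j k : Fin n, Integrable (fun x => (fun _ _ => 1 : Fin n → ℝ → ℝ) i x *
      (φ j x * φ k x)) μ := by simpa using fun _ : Fin n => h0
  have h1 := integrable_prod_mul_det_sq hint
  have h2 := integral_prod_mul_det_sq hint
  simp only [Finset.prod_const_one, one_mul, horth] at h1 h2
  refine ⟨h1, h2.trans ?_⟩
  have : ∀ σ : Equiv.Perm (Fin n),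
      (of fun i k => (1 : Matrix (Fin n) (Fin n) ℝ) (σ i) (σ k)).det = 1 := fun σ =>
    (det_submatrix_equiv_self σ (1 : Matrix (Fin n) (Fin n) ℝ)).trans det_one
  simp [this, Fintype.card_perm]

open Matrix in
lemma integral_apply_mul_det_sq (h0 : ∀ j k, Integrable (fun x => φ j x * φ k x) μ)
    (h1 : ∀ j k, Integrable (fun x => g x * (φ j x * φ k x)) μ)
    (horth : ∀ j k, ∫ x, φ j x * φ k x ∂μ = (1 : Matrix (Fin n) (Fin n) ℝ) j k) (a : Fin n) :
    Integrable (fun l : Fin n → ℝ => g (l a) * (of fun j i => φ j (l i)).det ^ 2)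
        (Measure.pi fun _ : Fin n => μ) ∧
      ∫ l : Fin n → ℝ, g (l a) * (of fun j i => φ j (l i)).det ^ 2
          ∂(Measure.pi fun _ : Fin n => μ) =
        ∑ σ : Equiv.Perm (Fin n), ∫ x, g x * (φ (σ a) x * φ (σ a) x) ∂μ := by
  set h : Fin n → ℝ → ℝ := fun i x => if i = a then g x else 1 with hh
  have hint : ∀ i j k : Fin n, Integrable (fun x => h i x * (φ j x * φ k x)) μ := by
    intro i j k
    by_cases hi : i = a <;> simp [hh, hi, h0, h1]
  have hp : ∀ l : Fin n → ℝ, ∏ i, h i (l i) = g (l a) := fun l => by simp [hh]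
  have e1 := integrable_prod_mul_det_sq hint
  have e2 := integral_prod_mul_det_sq hint
  simp only [hp] at e1 e2
  refine ⟨e1, e2.trans (Finset.sum_congr rfl fun σ _ => ?_)⟩
  refine Eq.trans ?_ (det_one_row a fun k => ∫ x, g x * (φ (σ a) x * φ (σ k) x) ∂μ)
  congr 1
  ext i k
  by_cases hi : i = a
  · simp [hh, hi]
  · simp [hh, hi, horth, one_apply]

open Matrix in
lemma integral_apply_mul_apply_mul_det_sq
    (h0 : ∀ j k, Integrable (fun x => φ j x * φ k x) μ)
    (h1 : ∀ j k, Integrable (fun x => g x * (φ j x * φ k x)) μ)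
    (horth : ∀ j k, ∫ x, φ j x * φ k x ∂μ = (1 : Matrix (Fin n) (Fin n) ℝ) j k)
    {a b : Fin n} (hab : a ≠ b) :
    Integrable (fun l : Fin n → ℝ => g (l a) * g (l b) * (of fun j i => φ j (l i)).det ^ 2)
        (Measure.pi fun _ : Fin n => μ) ∧
      ∫ l : Fin n → ℝ, g (l a) * g (l b) * (of fun j i => φ j (l i)).det ^ 2
          ∂(Measure.pi fun _ : Fin n => μ) =
        ∑ σ : Equiv.Perm (Fin n),
          ((∫ x, g x * (φ (σ a) x * φ (σ a) x) ∂μ) * (∫ x, g x * (φ (σ b) x * φ (σ b) x) ∂μ) -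
            (∫ x, g x * (φ (σ a) x * φ (σ b) x) ∂μ) ^ 2) := by
  set h : Fin n → ℝ → ℝ := fun i x => if i = a then g x else if i = b then g x else 1 with hh
  have hint : ∀ i j k : Fin n, Integrable (fun x => h i x * (φ j x * φ k x)) μ := by
    intro i j k
    by_cases hi : i = a
    · simp [hh, hi, h1]
    by_cases hi' : i = b <;> simp [hh, hi, hi', h0, h1, hab.symm]
  have hp : ∀ l : Fin n → ℝ, ∏ i, h i (l i) = g (l a) * g (l b) := fun l => by
    rw [← Finset.mul_prod_erase _ _ (Finset.mem_univ a),
      ← Finset.mul_prod_erase _ _ (Finset.mem_erase.2 ⟨hab.symm, Finset.mem_univ b⟩),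
      Finset.prod_eq_one, mul_one]
    · simp [hh]
    · intro i hi
      simp only [Finset.mem_erase] at hi
      simp [hh, hi.1, hi.2.1]
  have e1 := integrable_prod_mul_det_sq hint
  have e2 := integral_prod_mul_det_sq hint
  simp only [hp] at e1 e2
  refine ⟨e1, e2.trans (Finset.sum_congr rfl fun σ _ => ?_)⟩
  have e3 := det_two_rows hab (fun k => ∫ x, g x * (φ (σ a) x * φ (σ k) x) ∂μ)
    (fun k => ∫ x, g x * (φ (σ b) x * φ (σ k) x) ∂μ)
  have e4 : ∫ x, g x * (φ (σ b) x * φ (σ a) x) ∂μ = ∫ x, g x * (φ (σ a) x * φ (σ b) x) ∂μ := by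
    simp only [mul_comm (φ (σ b) _)]
  rw [e4, ← pow_two] at e3
  refine Eq.trans ?_ e3
  congr 1
  ext i k
  by_cases hi : i = a
  · simp [hh, hi]
  by_cases hi' : i = b
  · simp [hh, hi', hab.symm]
  · simp [hh, hi, hi', horth, one_apply]

open Matrix in
lemma integral_sum_mul_det_sq (h0 : ∀ j k, Integrable (fun x => φ j x * φ k x) μ)
    (h1 : ∀ j k, Integrable (fun x => g x * (φ j x * φ k x)) μ)
    (horth : ∀ j k, ∫ x, φ j x * φ k x ∂μ = (1 : Matrix (Fin n) (Fin n) ℝ) j k) :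
    ∫ l : Fin n → ℝ, (∑ a, g (l a)) * (of fun j i => φ j (l i)).det ^ 2
        ∂(Measure.pi fun _ : Fin n => μ) =
      n.factorial * ∑ a, ∫ x, g x * (φ a x * φ a x) ∂μ := by
  have key := integral_apply_mul_det_sq h0 h1 horth
  simp only [Finset.sum_mul]
  rw [integral_finsetSum _ fun a _ => (key a).1, Finset.sum_congr rfl fun a _ => (key a).2,
    Finset.sum_comm, Finset.sum_congr rfl fun σ _ =>
      Equiv.sum_comp σ fun a => ∫ x, g x * (φ a x * φ a x) ∂μ]
  simp [Fintype.card_perm]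

open Matrix in
lemma integral_sum_sq_mul_det_sq (h0 : ∀ j k, Integrable (fun x => φ j x * φ k x) μ)
    (h1 : ∀ j k, Integrable (fun x => g x * (φ j x * φ k x)) μ)
    (h2 : ∀ j k, Integrable (fun x => g x ^ 2 * (φ j x * φ k x)) μ)
    (horth : ∀ j k, ∫ x, φ j x * φ k x ∂μ = (1 : Matrix (Fin n) (Fin n) ℝ) j k) :
    Integrable (fun l : Fin n → ℝ => (∑ a, g (l a)) ^ 2 * (of fun j i => φ j (l i)).det ^ 2)
        (Measure.pi fun _ : Fin n => μ) ∧
      ∫ l : Fin n → ℝ, (∑ a, g (l a)) ^ 2 * (of fun j i => φ j (l i)).det ^ 2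
          ∂(Measure.pi fun _ : Fin n => μ) =
        n.factorial * (∑ a, ∫ x, g x ^ 2 * (φ a x * φ a x) ∂μ +
          (∑ a, ∫ x, g x * (φ a x * φ a x) ∂μ) ^ 2 -
            ∑ a, ∑ b, (∫ x, g x * (φ a x * φ b x) ∂μ) ^ 2) := by
  set F : Fin n → Fin n → ℝ := fun a b => ∫ x, g x * (φ a x * φ b x) ∂μ with hF
  set G : Fin n → ℝ := fun a => ∫ x, g x ^ 2 * (φ a x * φ a x) ∂μ with hG
  have key (a b : Fin n) :
      Integrable (fun l : Fin n → ℝ => g (l a) * g (l b) * (of fun j i => φ j (l i)).det ^ 2)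
          (Measure.pi fun _ : Fin n => μ) ∧
        ∫ l : Fin n → ℝ, g (l a) * g (l b) * (of fun j i => φ j (l i)).det ^ 2
            ∂(Measure.pi fun _ : Fin n => μ) =
          ∑ σ : Equiv.Perm (Fin n), ((if σ a = σ b then G (σ a) else 0) +
            (F (σ a) (σ a) * F (σ b) (σ b) - F (σ a) (σ b) ^ 2)) := by
    by_cases hab : a = b
    · subst hab
      have := integral_apply_mul_det_sq (g := fun x => g x ^ 2) h0 h2 horth a
      simpa only [← pow_two, hF, hG, if_true, sub_self, add_zero] using this
    · have := integral_apply_mul_apply_mul_det_sq h0 h1 horth hab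
      simpa only [hF, EmbeddingLike.apply_eq_iff_eq, hab, if_false, zero_add] using this
  simp only [pow_two (∑ a, g _), Finset.sum_mul_sum]
  simp only [Finset.sum_mul]
  refine ⟨integrable_finsetSum _ fun a _ => integrable_finsetSum _ fun b _ => (key a b).1, ?_⟩
  rw [integral_finsetSum _ fun a _ => integrable_finsetSum _ fun b _ => (key a b).1,
    Finset.sum_congr rfl fun a _ => (integral_finsetSum _ fun b _ => (key a b).1).trans
      (Finset.sum_congr rfl fun b _ => (key a b).2)]
  rw [Finset.sum_congr rfl fun a _ => Finset.sum_comm, Finset.sum_comm]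
  have (σ : Equiv.Perm (Fin n)) : ∑ a, ∑ b, ((if σ a = σ b then G (σ a) else 0) +
      (F (σ a) (σ a) * F (σ b) (σ b) - F (σ a) (σ b) ^ 2)) =
      ∑ a, G a + (∑ a, F a a) ^ 2 - ∑ a, ∑ b, F a b ^ 2 := by
    rw [Equiv.sum_comp σ fun a => ∑ b, ((if a = σ b then G a else 0) +
      (F a a * F (σ b) (σ b) - F a (σ b) ^ 2)), Finset.sum_congr rfl fun a _ =>
      Equiv.sum_comp σ fun b => ((if a = b then G a else 0) + (F a a * F b b - F a b ^ 2))]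
    simp only [Finset.sum_add_distrib, Finset.sum_sub_distrib, pow_two (∑ a, F a a),
      Finset.sum_mul_sum, Finset.sum_ite_eq, Finset.mem_univ, if_true]
    ring
  rw [Finset.sum_congr rfl fun σ _ => this σ]
  simp only [Finset.sum_const, Finset.card_univ, Fintype.card_perm, Fintype.card_fin,
    nsmul_eq_mul, hF]

end Moments

lemma vandSq_eq_det_vandermonde_sq {n : ℕ} (l : Fin n → ℝ) :
    vandSq l = (Matrix.vandermonde l).det ^ 2 := by
  rw [Matrix.det_vandermonde, vandSq, ← Finset.prod_pow]
  simp only [← Finset.prod_pow]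
  rw [Finset.prod_sigma']
  refine Finset.prod_bij' (fun q _ => ⟨q.2, q.1⟩) (fun q _ => (q.2, q.1)) ?_ ?_ ?_ ?_ ?_ <;> simp

lemma vandSq_nonneg {n : ℕ} (l : Fin n → ℝ) : 0 ≤ vandSq l :=
  Finset.prod_nonneg fun _ _ => sq_nonneg _

lemma measurable_vandSq {n : ℕ} : Measurable (vandSq : (Fin n → ℝ) → ℝ) := by
  unfold vandSq
  fun_prop

section Ensemble

variable {μ : Measure ℝ} {n : ℕ} {D : (Fin n → ℝ) → ℝ} {c Z : ℝ}

lemma lintegral_vandSq (hc : 0 < c) (hD : ∀ l, D l = c * vandSq l)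
    (hint : Integrable D (Measure.pi fun _ : Fin n => μ))
    (hZ : ∫ l, D l ∂(Measure.pi fun _ : Fin n => μ) = Z) :
    ((Measure.pi fun _ : Fin n => μ).withDensity fun l => ENNReal.ofReal (vandSq l)) Set.univ =
      ENNReal.ofReal (Z / c) := by
  have hv : (vandSq : (Fin n → ℝ) → ℝ) = fun l => c⁻¹ * D l := by
    ext l
    rw [hD, inv_mul_cancel_left₀ hc.ne']
  have hvi : Integrable (vandSq : (Fin n → ℝ) → ℝ) (Measure.pi fun _ : Fin n => μ) := by
    rw [hv]
    exact hint.const_mul _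
  rw [withDensity_apply _ MeasurableSet.univ, Measure.restrict_univ,
    ← ofReal_integral_eq_lintegral_ofReal hvi (ae_of_all _ vandSq_nonneg), hv,
    integral_const_mul, hZ, inv_mul_eq_div]

lemma isProbabilityMeasure_OPE (hc : 0 < c) (hD : ∀ l, D l = c * vandSq l)
    (hint : Integrable D (Measure.pi fun _ : Fin n => μ))
    (hZ : ∫ l, D l ∂(Measure.pi fun _ : Fin n => μ) = Z) (hZ0 : 0 < Z) :
    IsProbabilityMeasure (OPE μ n) := by
  constructor
  rw [OPE, Measure.smul_apply, lintegral_vandSq hc hD hint hZ, smul_eq_mul]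
  exact ENNReal.inv_mul_cancel (by simpa using div_pos hZ0 hc) ENNReal.ofReal_ne_top

lemma integrable_OPE (hc : 0 < c) (hD : ∀ l, D l = c * vandSq l)
    (hint : Integrable D (Measure.pi fun _ : Fin n => μ))
    (hZ : ∫ l, D l ∂(Measure.pi fun _ : Fin n => μ) = Z) (hZ0 : 0 < Z) {X : (Fin n → ℝ) → ℝ}
    (hX : Integrable (fun l => X l * D l) (Measure.pi fun _ : Fin n => μ)) :
    Integrable X (OPE μ n) := by
  rw [OPE, lintegral_vandSq hc hD hint hZ]
  refine Integrable.smul_measure ?_ (by simpa using div_pos hZ0 hc)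
  rw [integrable_withDensity_iff measurable_vandSq.ennreal_ofReal (by simp)]
  have : (fun l => X l * (ENNReal.ofReal (vandSq l)).toReal) = fun l => c⁻¹ * (X l * D l) := by
    ext l
    rw [ENNReal.toReal_ofReal (vandSq_nonneg l), hD]
    field_simp
  rw [this]
  exact hX.const_mul _

lemma integral_OPE (hc : 0 < c) (hD : ∀ l, D l = c * vandSq l)
    (hint : Integrable D (Measure.pi fun _ : Fin n => μ))
    (hZ : ∫ l, D l ∂(Measure.pi fun _ : Fin n => μ) = Z) (hZ0 : 0 < Z) (X : (Fin n → ℝ) → ℝ) :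
    ∫ l, X l ∂(OPE μ n) = (∫ l, X l * D l ∂(Measure.pi fun _ : Fin n => μ)) / Z := by
  rw [OPE, lintegral_vandSq hc hD hint hZ, integral_smul_measure,
    integral_withDensity_eq_integral_toReal_smul measurable_vandSq.ennreal_ofReal (by simp),
    ENNReal.toReal_inv, ENNReal.toReal_ofReal (div_pos hZ0 hc).le]
  have : (fun l => X l * D l) = fun l => c * ((ENNReal.ofReal (vandSq l)).toReal • X l) := by
    ext l
    rw [ENNReal.toReal_ofReal (vandSq_nonneg l), hD, smul_eq_mul]
    ring
  rw [this, integral_const_mul, smul_eq_mul]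
  field_simp

open Matrix in
/-- The variance of a linear statistic of the ensemble spanned by orthonormal functions whose
determinant is proportional to the Vandermonde determinant. -/
lemma variance_linStat_eq [IsProbabilityMeasure μ] {φ : Fin n → ℝ → ℝ} {g : ℝ → ℝ}
    (hg : Measurable g) (hc : 0 < c)
    (hD : ∀ l : Fin n → ℝ, (of fun j i => φ j (l i)).det ^ 2 = c * vandSq l)
    (h0 : ∀ j k, Integrable (fun x => φ j x * φ k x) μ)
    (h1 : ∀ j k, Integrable (fun x => g x * (φ j x * φ k x)) μ)
    (h2 : ∀ j k, Integrable (fun x => g x ^ 2 * (φ j x * φ k x)) μ)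
    (horth : ∀ j k, ∫ x, φ j x * φ k x ∂μ = (1 : Matrix (Fin n) (Fin n) ℝ) j k) :
    variance (fun l : Fin n → ℝ => linStat g l) (OPE μ n) =
      ∑ a, ∫ x, g x ^ 2 * (φ a x * φ a x) ∂μ -
        ∑ a, ∑ b, (∫ x, g x * (φ a x * φ b x) ∂μ) ^ 2 := by
  obtain ⟨hint, hZ⟩ := integral_det_sq h0 horth
  have hZ0 : (0 : ℝ) < n.factorial := by exact_mod_cast n.factorial_pos
  have := isProbabilityMeasure_OPE hc hD hint hZ hZ0
  obtain ⟨hi2, he2⟩ := integral_sum_sq_mul_det_sq h0 h1 h2 horth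
  have hm : Measurable fun l : Fin n → ℝ => linStat g l := by
    unfold linStat
    fun_prop
  have hL : MemLp (fun l : Fin n → ℝ => linStat g l) 2 (OPE μ n) :=
    (memLp_two_iff_integrable_sq hm.aestronglyMeasurable).2
      (integrable_OPE hc hD hint hZ hZ0 hi2)
  rw [variance_eq_sub hL, integral_OPE hc hD hint hZ hZ0, integral_OPE hc hD hint hZ hZ0]
  simp only [Pi.pow_apply, linStat]
  rw [he2, integral_sum_mul_det_sq h0 h1 horth]
  field_simp
  ring

end Ensemble

section DoubleIntegral

variable {μ : Measure ℝ} [IsProbabilityMeasure μ] {n : ℕ} {φ : Fin n → ℝ → ℝ} {g : ℝ → ℝ}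

/-- The variance of a linear statistic as a double integral against the squared kernel. -/
lemma integral_sub_sq_mul_kernel_sq (h0 : ∀ j k, Integrable (fun x => φ j x * φ k x) μ)
    (h1 : ∀ j k, Integrable (fun x => g x * (φ j x * φ k x)) μ)
    (h2 : ∀ j k, Integrable (fun x => g x ^ 2 * (φ j x * φ k x)) μ)
    (horth : ∀ j k, ∫ x, φ j x * φ k x ∂μ = (1 : Matrix (Fin n) (Fin n) ℝ) j k) :
    Integrable (fun z : ℝ × ℝ => (g z.1 - g z.2) ^ 2 * (∑ a, φ a z.1 * φ a z.2) ^ 2) (μ.prod μ) ∧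
      ∫ z : ℝ × ℝ, (g z.1 - g z.2) ^ 2 * (∑ a, φ a z.1 * φ a z.2) ^ 2 ∂(μ.prod μ) =
        2 * (∑ a, ∫ x, g x ^ 2 * (φ a x * φ a x) ∂μ -
          ∑ a, ∑ b, (∫ x, g x * (φ a x * φ b x) ∂μ) ^ 2) := by
  have hexp : (fun z : ℝ × ℝ => (g z.1 - g z.2) ^ 2 * (∑ a, φ a z.1 * φ a z.2) ^ 2) =
      fun z => ∑ a, ∑ b, ((g z.1 ^ 2 * (φ a z.1 * φ b z.1)) * (φ a z.2 * φ b z.2) +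
        (φ a z.1 * φ b z.1) * (g z.2 ^ 2 * (φ a z.2 * φ b z.2)) -
        2 * ((g z.1 * (φ a z.1 * φ b z.1)) * (g z.2 * (φ a z.2 * φ b z.2)))) := by
    ext z
    rw [pow_two (∑ a, _), Finset.sum_mul_sum, Finset.mul_sum]
    refine Finset.sum_congr rfl fun a _ => ?_
    rw [Finset.mul_sum]
    exact Finset.sum_congr rfl fun b _ => by ring
  have i1 a b := (h2 a b).mul_prod (h0 a b)
  have i2 a b := (h0 a b).mul_prod (h2 a b)
  have i3 a b := ((h1 a b).mul_prod (h1 a b)).const_mul 2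
  have i12 a b : Integrable (fun z : ℝ × ℝ => (g z.1 ^ 2 * (φ a z.1 * φ b z.1)) *
      (φ a z.2 * φ b z.2) + (φ a z.1 * φ b z.1) * (g z.2 ^ 2 * (φ a z.2 * φ b z.2))) (μ.prod μ) :=
    (i1 a b).add (i2 a b)
  have i4 a b : Integrable (fun z : ℝ × ℝ => (g z.1 ^ 2 * (φ a z.1 * φ b z.1)) *
      (φ a z.2 * φ b z.2) + (φ a z.1 * φ b z.1) * (g z.2 ^ 2 * (φ a z.2 * φ b z.2)) -
      2 * ((g z.1 * (φ a z.1 * φ b z.1)) * (g z.2 * (φ a z.2 * φ b z.2)))) (μ.prod μ) :=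
    (i12 a b).sub (i3 a b)
  rw [hexp]
  refine ⟨integrable_finsetSum _ fun a _ => integrable_finsetSum _ fun b _ => i4 a b, ?_⟩
  rw [integral_finsetSum _ fun a _ => integrable_finsetSum _ fun b _ => i4 a b]
  have key a b : ∫ z : ℝ × ℝ, ((g z.1 ^ 2 * (φ a z.1 * φ b z.1)) * (φ a z.2 * φ b z.2) +
        (φ a z.1 * φ b z.1) * (g z.2 ^ 2 * (φ a z.2 * φ b z.2)) -
        2 * ((g z.1 * (φ a z.1 * φ b z.1)) * (g z.2 * (φ a z.2 * φ b z.2)))) ∂(μ.prod μ) =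
      2 * ((if a = b then ∫ x, g x ^ 2 * (φ a x * φ a x) ∂μ else 0) -
        (∫ x, g x * (φ a x * φ b x) ∂μ) ^ 2) := by
    rw [integral_sub (i12 a b) (i3 a b), integral_add (i1 a b) (i2 a b),
      integral_const_mul,
      integral_prod_mul (fun x => g x ^ 2 * (φ a x * φ b x)) (fun x => φ a x * φ b x),
      integral_prod_mul (fun x => φ a x * φ b x) (fun x => g x ^ 2 * (φ a x * φ b x)),
      integral_prod_mul (fun x => g x * (φ a x * φ b x)) (fun x => g x * (φ a x * φ b x)), horth]
    by_cases hab : a = b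
    · subst hab
      simp
      ring
    · simp [hab]
      ring
  rw [Finset.sum_congr rfl fun a _ => (integral_finsetSum _ fun b _ => i4 a b).trans
    (Finset.sum_congr rfl fun b _ => key a b)]
  simp only [← Finset.mul_sum, Finset.sum_sub_distrib, Finset.sum_ite_eq, Finset.mem_univ, if_true]

end DoubleIntegral

section Polynomials

open Polynomial

variable {μ : Measure ℝ} {p : ℕ → ℝ[X]}

lemma HasAllMoments.integrable_eval (hmom : HasAllMoments μ) (q : ℝ[X]) :
    Integrable (fun x => q.eval x) μ := by
  simp only [eval_eq_sum_range]
  exact integrable_finsetSum _ fun k _ => (hmom k).const_mul _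

lemma HasAllMoments.integrable_eval_mul (hmom : HasAllMoments μ) (q r : ℝ[X]) :
    Integrable (fun x => q.eval x * r.eval x) μ := by
  simpa using hmom.integrable_eval (q * r)

/-- Functions dominated by a polynomial are integrable against polynomials. -/
lemma HasAllMoments.integrable_mul_eval (hmom : HasAllMoments μ) {g : ℝ → ℝ} (hg : Measurable g)
    {B : ℝ[X]} (hB : ∀ x, |g x| ≤ B.eval x) (q : ℝ[X]) :
    Integrable (fun x => g x * q.eval x) μ := by
  refine (hmom.integrable_eval (B * q)).mono (by fun_prop) (ae_of_all _ fun x => ?_)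
  rw [eval_mul, norm_mul, norm_mul, Real.norm_eq_abs, Real.norm_eq_abs (B.eval x)]
  exact mul_le_mul_of_nonneg_right ((hB x).trans (le_abs_self _)) (norm_nonneg _)

lemma exists_polynomial_bound {g : ℝ → ℝ} {M : ℝ} (hM : 0 ≤ M)
    (hg : ∀ x y, |g x - g y| ≤ M * |x - y|) : ∃ B : ℝ[X], ∀ x, |g x| ≤ B.eval x := by
  refine ⟨C (|g 0| + M) + C M * X ^ 2, fun x => ?_⟩
  have h1 := hg x 0
  have h2 : |g x| ≤ |g x - g 0| + |g 0| := by
    simpa using abs_add_le (g x - g 0) (g 0)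
  have h3 : M * |x| ≤ M * (1 + x ^ 2) :=
    mul_le_mul_of_nonneg_left (by nlinarith [sq_abs x, sq_nonneg (|x| - 1), abs_nonneg x]) hM
  simp only [sub_zero] at h1
  simp only [eval_add, eval_C, eval_mul, eval_pow, eval_X]
  linarith

lemma IsOrthonormalPolys.exists_expansion (hp : IsOrthonormalPolys μ p) (m : ℕ) :
    ∀ q : ℝ[X], q.degree < m → ∃ c : ℕ → ℝ, q = ∑ k ∈ Finset.range m, C (c k) * p k := by
  induction m with
  | zero =>
    intro q hq
    exact ⟨0, by simpa using hq⟩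
  | succ m ih =>
    intro q hq
    have hγ := (hp.2.1 m).ne'
    have hnat : (p m).natDegree = m := natDegree_eq_of_degree_eq_some (hp.1 m)
    have hlow : (q - C (q.coeff m / (p m).leadingCoeff) * p m).degree < m := by
      rw [degree_lt_iff_coeff_zero]
      intro k hk
      rcases hk.eq_or_lt with rfl | hk
      · have : (p m).coeff m = (p m).leadingCoeff := by rw [leadingCoeff, hnat]
        rw [coeff_sub, coeff_C_mul, this, div_mul_cancel₀ _ hγ, sub_self]
      · rw [coeff_sub, coeff_C_mul, coeff_eq_zero_of_natDegree_lt (hnat.trans_lt hk),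
          (degree_lt_iff_coeff_zero _ _).1 hq k hk]
        simp
    obtain ⟨c, hc⟩ := ih _ hlow
    refine ⟨Function.update c m (q.coeff m / (p m).leadingCoeff), ?_⟩
    rw [Finset.sum_range_succ, Function.update_self, ← sub_eq_iff_eq_add, hc]
    refine Finset.sum_congr rfl fun k hk => ?_
    rw [Function.update_of_ne (Finset.mem_range.1 hk).ne]

lemma IsOrthonormalPolys.eq_sum (hp : IsOrthonormalPolys μ p) (hmom : HasAllMoments μ) {m : ℕ}
    {q : ℝ[X]} (hq : q.degree < m) :
    q = ∑ k ∈ Finset.range m, C (∫ x, q.eval x * (p k).eval x ∂μ) * p k := by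
  obtain ⟨c, hc⟩ := hp.exists_expansion m q hq
  conv_lhs => rw [hc]
  refine Finset.sum_congr rfl fun k hk => ?_
  have h1 (j : ℕ) : Integrable (fun x => c j * ((p j).eval x * (p k).eval x)) μ :=
    (hmom.integrable_eval_mul _ _).const_mul _
  have h2 : ∀ x, q.eval x * (p k).eval x =
      ∑ j ∈ Finset.range m, c j * ((p j).eval x * (p k).eval x) := fun x => by
    conv_lhs => rw [hc]
    simp only [eval_finsetSum, eval_mul, eval_C, Finset.sum_mul, mul_assoc]
  simp only [h2]
  rw [integral_finsetSum _ fun j _ => h1 j]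
  simp only [integral_const_mul, hp.2.2]
  simp [Finset.mem_range.1 hk]

/-- Parseval's identity for polynomials. -/
lemma IsOrthonormalPolys.integral_sq (hp : IsOrthonormalPolys μ p) (hmom : HasAllMoments μ)
    {m : ℕ} {q : ℝ[X]} (hq : q.degree < m) :
    ∫ x, q.eval x * q.eval x ∂μ =
      ∑ k ∈ Finset.range m, (∫ x, q.eval x * (p k).eval x ∂μ) ^ 2 := by
  have h : ∀ x, q.eval x * q.eval x = ∑ k ∈ Finset.range m,
      (∫ x, q.eval x * (p k).eval x ∂μ) * (q.eval x * (p k).eval x) := fun x => by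
    conv_lhs => enter [2]; rw [hp.eq_sum hmom hq]
    simp only [eval_finsetSum, eval_mul, eval_C, Finset.mul_sum]
    exact Finset.sum_congr rfl fun k _ => by ring
  rw [integral_congr_ae (ae_of_all _ h),
    integral_finsetSum _ fun k _ => (hmom.integrable_eval_mul _ _).const_mul _]
  simp only [integral_const_mul, pow_two]

lemma IsOrthonormalPolys.coeff_eq (hp : IsOrthonormalPolys μ p) (hmom : HasAllMoments μ)
    {m : ℕ} {q : ℝ[X]} (hq : q.degree < (m + 1 : ℕ)) :
    q.coeff m = (∫ x, q.eval x * (p m).eval x ∂μ) * (p m).leadingCoeff := by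
  have hnat (k : ℕ) : (p k).natDegree = k := natDegree_eq_of_degree_eq_some (hp.1 k)
  conv_lhs => rw [hp.eq_sum hmom hq]
  rw [Finset.sum_range_succ, coeff_add, finsetSum_coeff, Finset.sum_eq_zero, zero_add,
    coeff_C_mul, leadingCoeff, hnat]
  intro k hk
  rw [coeff_C_mul, coeff_eq_zero_of_natDegree_lt (by rw [hnat]; exact Finset.mem_range.1 hk),
    mul_zero]

lemma IsOrthonormalPolys.degree_X_mul_lt (hp : IsOrthonormalPolys μ p) {j m : ℕ} (h : j ≤ m) :
    (X * p j).degree < ((m + 2 : ℕ) : WithBot ℕ) := by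
  rw [degree_mul, degree_X, hp.1]
  exact_mod_cast (by omega : 1 + j < m + 2)

lemma IsOrthonormalPolys.integral_X_mul (hp : IsOrthonormalPolys μ p) (hmom : HasAllMoments μ)
    {j m : ℕ} (h : j ≤ m) :
    ∫ x, (X * p j).eval x * (p (m + 1)).eval x ∂μ =
      if j = m then (p m).leadingCoeff / (p (m + 1)).leadingCoeff else 0 := by
  have hnat (k : ℕ) : (p k).natDegree = k := natDegree_eq_of_degree_eq_some (hp.1 k)
  rw [← mul_div_cancel_right₀ (∫ x, _ ∂μ) (hp.2.1 (m + 1)).ne',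
    ← hp.coeff_eq hmom (hp.degree_X_mul_lt h), coeff_X_mul]
  split_ifs with hj
  · rw [hj, leadingCoeff, leadingCoeff, hnat, hnat]
  · rw [coeff_eq_zero_of_natDegree_lt (by rw [hnat]; omega), zero_div]

/-- The double-sum expression of the variance, evaluated at the identity function. -/
lemma IsOrthonormalPolys.variance_id (hp : IsOrthonormalPolys μ p) (hmom : HasAllMoments μ)
    (m : ℕ) :
    ∑ a : Fin (m + 1), ∫ x, x ^ 2 * ((p a).eval x * (p a).eval x) ∂μ -
        ∑ a : Fin (m + 1), ∑ b : Fin (m + 1), (∫ x, x * ((p a).eval x * (p b).eval x) ∂μ) ^ 2 =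
      ((p m).leadingCoeff / (p (m + 1)).leadingCoeff) ^ 2 := by
  have h1 (a : Fin (m + 1)) : ∫ x, x ^ 2 * ((p a).eval x * (p a).eval x) ∂μ -
      ∑ b : Fin (m + 1), (∫ x, x * ((p a).eval x * (p b).eval x) ∂μ) ^ 2 =
      if (a : ℕ) = m then ((p m).leadingCoeff / (p (m + 1)).leadingCoeff) ^ 2 else 0 := by
    have ha : (a : ℕ) ≤ m := Nat.lt_succ_iff.1 a.2
    have h2 := hp.integral_sq hmom (hp.degree_X_mul_lt ha)
    rw [Finset.sum_range_succ, hp.integral_X_mul hmom ha, ← Fin.sum_univ_eq_sum_range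
      (fun k => (∫ x, ((X : ℝ[X]) * p a).eval x * (p k).eval x ∂μ) ^ 2)] at h2
    have h3 : ∫ x, x ^ 2 * ((p a).eval x * (p a).eval x) ∂μ =
        ∫ x, (X * p a).eval x * (X * p a).eval x ∂μ := by
      congr 1
      ext x
      simp only [eval_mul, eval_X]
      ring
    rw [h3, h2]
    simp only [eval_mul, eval_X, mul_assoc, add_sub_cancel_left]
    split_ifs <;> simp
  rw [← Finset.sum_sub_distrib, Finset.sum_congr rfl fun a _ => h1 a,
    Fin.sum_univ_eq_sum_range
      (fun a => if a = m then ((p m).leadingCoeff / (p (m + 1)).leadingCoeff) ^ 2 else 0)]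
  simp

open Matrix in
lemma IsOrthonormalPolys.exists_det_sq_eq (hp : IsOrthonormalPolys μ p) (n : ℕ) :
    ∃ c : ℝ, 0 < c ∧ ∀ l : Fin n → ℝ,
      (of fun (j i : Fin n) => (p j).eval (l i)).det ^ 2 = c * vandSq l := by
  have hnat (k : ℕ) : (p k).natDegree = k := natDegree_eq_of_degree_eq_some (hp.1 k)
  refine ⟨(∏ j : Fin n, (p j).leadingCoeff) ^ 2,
    pow_pos (Finset.prod_pos fun (j : Fin n) _ => hp.2.1 j) 2, fun l => ?_⟩
  have h1 := eval_matrixOfPolynomials_eq_vandermonde_mul_matrixOfPolynomials l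
    (fun j : Fin n => p j) fun j => (hnat j).le
  have h2 : (of fun i j : Fin n => (p j).coeff i).det = ∏ j : Fin n, (p j).leadingCoeff := by
    rw [det_of_isUpperTriangular]
    · exact Finset.prod_congr rfl fun j _ => by rw [of_apply, leadingCoeff, hnat]
    · intro i j hij
      exact coeff_eq_zero_of_natDegree_lt (by rw [hnat]; exact hij)
  rw [vandSq_eq_det_vandermonde_sq, ← mul_pow, mul_comm, ← h2, ← det_mul, ← h1,
    ← det_transpose]
  rfl

/-- The variance bound for unscaled Lipschitz linear statistics. -/
lemma IsOrthonormalPolys.variance_linStat_le [IsProbabilityMeasure μ]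
    (hp : IsOrthonormalPolys μ p) (hmom : HasAllMoments μ) {g : ℝ → ℝ} {M : ℝ} (hM : 0 ≤ M)
    (hg : ∀ x y, |g x - g y| ≤ M * |x - y|) (n : ℕ) :
    variance (fun l : Fin n → ℝ => linStat g l) (OPE μ n) ≤
      M ^ 2 * ((p (n - 1)).leadingCoeff / (p n).leadingCoeff) ^ 2 := by
  rcases n with _ | m
  · have : (fun l : Fin 0 → ℝ => linStat g l) = 0 := by
      ext l
      simp [linStat]
    rw [this, variance_zero]
    positivity
  have hgm : Measurable g :=
    (LipschitzWith.of_dist_le_mul (K := M.toNNReal) fun x y => by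
      simpa [Real.dist_eq, Real.coe_toNNReal _ hM] using hg x y).continuous.measurable
  obtain ⟨B, hB⟩ := exists_polynomial_bound hM hg
  obtain ⟨c, hc, hD⟩ := hp.exists_det_sq_eq (m + 1)
  have h0 (j k : Fin (m + 1)) : Integrable (fun x => (p j).eval x * (p k).eval x) μ :=
    hmom.integrable_eval_mul _ _
  have horth (j k : Fin (m + 1)) : ∫ x, (p j).eval x * (p k).eval x ∂μ =
      (1 : Matrix (Fin (m + 1)) (Fin (m + 1)) ℝ) j k := by
    simp [hp.2.2, Matrix.one_apply, Fin.ext_iff]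
  have h1 (j k : Fin (m + 1)) : Integrable (fun x => g x * ((p j).eval x * (p k).eval x)) μ := by
    simpa using hmom.integrable_mul_eval hgm hB (p j * p k)
  have h2 (j k : Fin (m + 1)) :
      Integrable (fun x => g x ^ 2 * ((p j).eval x * (p k).eval x)) μ := by
    have hB2 : ∀ x, |g x ^ 2| ≤ (B ^ 2).eval x := fun x => by
      rw [abs_pow, eval_pow]
      exact pow_le_pow_left₀ (abs_nonneg _) (hB x) 2
    simpa using hmom.integrable_mul_eval (hgm.pow_const 2) hB2 (p j * p k)
  have h1' (j k : Fin (m + 1)) : Integrable (fun x => x * ((p j).eval x * (p k).eval x)) μ := by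
    simpa only [eval_mul, eval_pow, eval_X] using hmom.integrable_eval ((X : ℝ[X]) * (p j * p k))
  have h2' (j k : Fin (m + 1)) :
      Integrable (fun x => x ^ 2 * ((p j).eval x * (p k).eval x)) μ := by
    simpa only [eval_mul, eval_pow, eval_X] using
      hmom.integrable_eval ((X : ℝ[X]) ^ (2 : ℕ) * (p j * p k))
  rw [variance_linStat_eq (φ := fun j x => (p j).eval x) hgm hc hD h0 h1 h2 horth,
    Nat.add_sub_cancel, ← hp.variance_id hmom m]
  obtain ⟨i1, e1⟩ := integral_sub_sq_mul_kernel_sq (φ := fun j x => (p j).eval x) h0 h1 h2 horth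
  obtain ⟨i2, e2⟩ := integral_sub_sq_mul_kernel_sq (g := fun x => x)
    (φ := fun j x => (p j).eval x) h0 h1' h2' horth
  have hmono := integral_mono i1 (i2.const_mul (M ^ 2)) fun z => by
    rw [← mul_assoc, ← mul_pow M]
    refine mul_le_mul_of_nonneg_right ?_ (sq_nonneg _)
    rw [← sq_abs, ← sq_abs (M * _), abs_mul, abs_of_nonneg hM]
    exact pow_le_pow_left₀ (abs_nonneg _) (hg _ _) 2
  rw [e1, integral_const_mul, e2] at hmono
  linarith

/-- The ratio of consecutive leading coefficients is bounded by the size of the support. -/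
lemma IsOrthonormalPolys.leadingCoeff_div_le (hp : IsOrthonormalPolys μ p)
    (hmom : HasAllMoments μ) {R : ℝ} (hR : ∀ᵐ x ∂μ, |x| ≤ R) (m : ℕ) :
    (p m).leadingCoeff / (p (m + 1)).leadingCoeff ≤ R := by
  have h := hp.integral_X_mul hmom (le_refl m)
  rw [if_pos rfl] at h
  have h1 (k : ℕ) : Integrable (fun x => (p k).eval x * (p k).eval x) μ :=
    hmom.integrable_eval_mul _ _
  have hle : ∫ x, (X * p m).eval x * (p (m + 1)).eval x ∂μ ≤
      ∫ x, R / 2 * ((p m).eval x * (p m).eval x + (p (m + 1)).eval x * (p (m + 1)).eval x) ∂μ := by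
    refine integral_mono_ae (hmom.integrable_eval_mul _ _)
      (((h1 m).add (h1 (m + 1))).const_mul _) ?_
    filter_upwards [hR] with x hx
    set u := (p m).eval x
    set v := (p (m + 1)).eval x
    have hR0 : 0 ≤ R := (abs_nonneg x).trans hx
    calc (X * p m).eval x * v = x * (u * v) := by rw [eval_mul, eval_X, mul_assoc]
      _ ≤ |x| * |u * v| := by rw [← abs_mul]; exact le_abs_self _
      _ ≤ R * |u * v| := mul_le_mul_of_nonneg_right hx (abs_nonneg _)
      _ ≤ R * ((u * u + v * v) / 2) := by
        refine mul_le_mul_of_nonneg_left (abs_le.2 ⟨?_, ?_⟩) hR0 <;>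
          nlinarith [sq_nonneg (u + v), sq_nonneg (u - v)]
      _ = R / 2 * (u * u + v * v) := by ring
  rw [integral_const_mul, integral_add (h1 _) (h1 _), hp.2.2, hp.2.2, if_pos rfl, if_pos rfl,
    h] at hle
  linarith

end Polynomials

/-- **Variance bound for Lipschitz linear statistics** (Proposition 4.4): for any
probability measure `μ` with infinite support and all moments finite, `x* ∈ ℝ`, `α ≥ 0`
and Lipschitz `f` with constant `|f|_L`,
`Var X_{f,α,x*}^{(n)} ≤ |f|_L² (γ_{n-1}/γ_n)² n^{2α}`; in particular if `μ` has compact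
support then `Var X_f^{(n)}` is bounded uniformly in `n`. -/
theorem variance_lipschitz_bound
    (μ : Measure ℝ) (hprob : IsProbabilityMeasure μ)
    (hinf : InfiniteSupport μ) (hmom : HasAllMoments μ)
    (p : ℕ → Polynomial ℝ) (hp : IsOrthonormalPolys μ p)
    (xs : ℝ) (α : ℝ) (hα : 0 ≤ α)
    (f : ℝ → ℝ) (L : ℝ) (hL : 0 ≤ L) (hf : ∀ x y : ℝ, |f x - f y| ≤ L * |x - y|) :
    (∀ n : ℕ,
      variance (fun l : Fin n → ℝ => scaledLinStat f α xs l) (OPE μ n) ≤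
        L ^ 2 * ((p (n - 1)).leadingCoeff / (p n).leadingCoeff) ^ 2 * (n : ℝ) ^ (2 * α)) ∧
    ((∃ K : Set ℝ, IsCompact K ∧ μ Kᶜ = 0) →
      ∃ C : ℝ, ∀ n : ℕ,
        variance (fun l : Fin n → ℝ => linStat f l) (OPE μ n) ≤ C) := by
  refine ⟨fun n => ?_, ?_⟩
  · have hg : ∀ x y : ℝ, |f ((n : ℝ) ^ α * (x - xs)) - f ((n : ℝ) ^ α * (y - xs))| ≤
        L * (n : ℝ) ^ α * |x - y| := fun x y => by
      refine (hf _ _).trans_eq ?_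
      rw [← mul_sub, sub_sub_sub_cancel_right, abs_mul,
        abs_of_nonneg (Real.rpow_nonneg n.cast_nonneg α), mul_assoc]
    refine (hp.variance_linStat_le hmom (by positivity) hg n).trans_eq ?_
    rw [mul_pow, ← Real.rpow_natCast ((n : ℝ) ^ α), ← Real.rpow_mul n.cast_nonneg]
    push_cast
    ring_nf
  · rintro ⟨K, hK, hμK⟩
    obtain ⟨R, hR⟩ := hK.isBounded.exists_norm_le
    have hae : ∀ᵐ x ∂μ, |x| ≤ R := by
      have hmem : ∀ᵐ x ∂μ, x ∈ K := hμK
      filter_upwards [hmem] with x hx using hR x hx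
    refine ⟨L ^ 2 * (1 + R ^ 2), fun n => (hp.variance_linStat_le hmom hL hf n).trans ?_⟩
    refine mul_le_mul_of_nonneg_left ?_ (sq_nonneg L)
    rcases n with _ | m
    · rw [Nat.zero_sub, div_self (hp.2.1 0).ne']
      nlinarith [sq_nonneg R]
    · have h := pow_le_pow_left₀ (div_pos (hp.2.1 m) (hp.2.1 (m + 1))).le
        (hp.leadingCoeff_div_le hmom hae m) 2
      rw [Nat.add_sub_cancel]
      linarith
end
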